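/- Fix a positive integer k and positive integers d_1, …, d_k. There exists a constant C > 0, depending only on d_1, …, d_k, such that for every prime power q the following holds: if f_1, …, f_k are chosen independently, with each f_i uniform on F_q[X_1,…,X_k]_{≤d_i}, then the probability that the number of points x ∈ F_q^k with f_1(x) = ⋯ = f_k(x) = 0 exceeds d_1·d_2 ⋯ d_k is at most C·q^{−min(d_1,…,d_k)}. -/

import Mathlib

open Polynomial in
lemma aux_height_poly {R : Type*} [CommRing R] (p : Ideal R) [p.IsPrime] (P : Ideal R[X])
    [P.IsPrime] (hlt : p.map C < P) : p.height + 1 ≤ P.height := by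
  refine le_trans ?_ (Ideal.height_add_one_le_of_lt_of_isPrime hlt)
  gcongr
  let φ : PrimeSpectrum R → PrimeSpectrum R[X] := fun q => ⟨q.asIdeal.map C, inferInstance⟩
  have hφ : StrictMono φ := by
    apply Monotone.strictMono_of_injective
    · intro a b hab
      exact Ideal.map_mono hab
    · intro a b hab
      have h : a.asIdeal.map (C : R →+* R[X]) = b.asIdeal.map C := congrArg PrimeSpectrum.asIdeal hab
      ext x
      have := congrArg (fun I => C x ∈ I) h
      have hc : ∀ q : Ideal R, C x ∈ q.map (C : R →+* R[X]) ↔ x ∈ q := by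
        intro q
        rw [Ideal.mem_map_C_iff]
        constructor
        · intro h; simpa using h 0
        · intro h n
          rw [coeff_C]; split_ifs <;> simp [h]
      simpa [hc] using this
  have := Order.height_le_height_apply_of_strictMono φ hφ ⟨p, inferInstance⟩
  rwa [← PrimeSpectrum.height_eq_orderHeight, ← PrimeSpectrum.height_eq_orderHeight] at this

lemma aux_height_alg {A : Type*} [CommRing A] [IsDomain A] (T : Type*) [Finite T] :
    ∀ (P : Ideal (MvPolynomial T A)), P.IsPrime → (∀ a, MvPolynomial.C a ∈ P → a = 0) →
      (∀ i : T, ∃ g : Polynomial A, g ≠ 0 ∧ Polynomial.aeval (MvPolynomial.X i) g ∈ P) →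
      (Nat.card T : ℕ∞) ≤ P.height := by
  induction T using Finite.induction_empty_option with
  | of_equiv e ih =>
    intro P hP h0 hg
    let E := (MvPolynomial.renameEquiv A e)
    let E' := E.toRingEquiv
    have := ih (P.comap E') (hP.comap _) (by
      intro a ha
      apply h0
      simpa [E', E] using ha) (by
      intro i
      obtain ⟨g, hg0, hg⟩ := hg (e i)
      refine ⟨g, hg0, ?_⟩
      rw [Ideal.mem_comap]
      convert hg
      change E (Polynomial.aeval _ g) = _
      rw [← Polynomial.aeval_algHom_apply]
      simp [E])
    rw [Nat.card_congr e, RingEquiv.height_comap E' P] at this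
    exact this
  | h_empty => simp
  | @h_option T _ ih =>
    intro P hP h0 hg
    let E := MvPolynomial.optionEquivLeft A T
    let E' := E.symm.toRingEquiv
    let P' : Ideal (Polynomial (MvPolynomial T A)) := P.comap E'
    have hP' : P'.IsPrime := hP.comap _
    let p : Ideal (MvPolynomial T A) := P'.comap Polynomial.C
    have hp : p.IsPrime := hP'.comap _
    have hmem : ∀ x, x ∈ P → E x ∈ P' := by
      intro x hx
      change E.symm (E x) ∈ P
      simpa using hx
    have hmem' : ∀ x, E x ∈ P' → x ∈ P := by
      intro x hx
      change E.symm (E x) ∈ P at hx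
      simpa using hx
    have h0' : ∀ a, MvPolynomial.C a ∈ p → a = 0 := by
      intro a ha
      apply h0
      apply hmem'
      change Polynomial.C (MvPolynomial.C a) ∈ P' at ha
      simpa [E, MvPolynomial.optionEquivLeft_C] using ha
    have h1 := ih p hp h0' (by
      intro i
      obtain ⟨g, hg0, hg⟩ := hg (some i)
      refine ⟨g, hg0, ?_⟩
      have := hmem _ hg
      rw [← Polynomial.aeval_algHom_apply] at this
      simp only [E, MvPolynomial.optionEquivLeft_X_some] at this
      change Polynomial.C _ ∈ P'
      convert this
      symm
      exact Polynomial.aeval_algHom_apply (Polynomial.CAlgHom (R := MvPolynomial T A) |>.restrictScalars A) _ g)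
    have h2 : p.height + 1 ≤ P'.height := by
      apply aux_height_poly
      refine lt_of_le_of_ne (Ideal.map_le_iff_le_comap.2 le_rfl) ?_
      intro heq
      obtain ⟨g, hg0, hg⟩ := hg none
      have := hmem _ hg
      rw [← Polynomial.aeval_algHom_apply] at this
      simp only [E, MvPolynomial.optionEquivLeft_X_none] at this
      rw [← heq, Ideal.mem_map_C_iff] at this
      apply hg0
      ext n
      apply h0'
      convert this n
      have : (Polynomial.aeval (Polynomial.X : Polynomial (MvPolynomial T A))) g = g.map MvPolynomial.C := by
        clear this hg hg0
        induction g using Polynomial.induction_on' with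
        | add p q hp hq => simp [hp, hq]
        | monomial n a => 
          rw [Polynomial.aeval_monomial, Polynomial.map_monomial, ← Polynomial.C_mul_X_pow_eq_monomial]
          rfl
      rw [this, Polynomial.coeff_map]
    have h3 : P'.height = P.height := RingEquiv.height_comap E' P
    rw [← h3]
    refine le_trans ?_ h2
    simp only [Finite.card_option]
    push_cast
    gcongr

attribute [local instance] Polynomial.algebra in
open Polynomial in
lemma aux_dep {A : Type*} [CommRing A] [IsDomain A] {T : Type*} [Fintype T] [DecidableEq T]
    (d : T → ℕ) (f : T → MvPolynomial T A) (hf : ∀ i, (f i).totalDegree ≤ d i)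
    {ι : Type*} [Fintype ι] (h : ι → MvPolynomial T A) (hcard : ∏ i, d i < Fintype.card ι) :
    ∃ r : ι → A[X], (∃ i, r i ≠ 0) ∧
      ∑ i, (r i).map (MvPolynomial.C (σ := T)) * C (h i) ∈
        Ideal.span (Set.range fun i : T => C (f i) + X * C (MvPolynomial.X i ^ d i)) := by
  classical
  set G : T → (MvPolynomial T A)[X] := fun i => C (f i) + X * C (MvPolynomial.X i ^ d i) with hG
  let mon : ((i : T) → Fin (d i)) → (MvPolynomial T A)[X] :=
    fun a => C (∏ i, MvPolynomial.X i ^ (a i : ℕ))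
  let ψ := Fintype.linearCombination A[X] mon
  let U : Submodule A[X] (MvPolynomial T A)[X] :=
    (Submodule.restrictScalars A[X] (Ideal.span (Set.range G))) ⊔ LinearMap.range ψ
  let lam : MvPolynomial T A →ₗ[A] ((MvPolynomial T A)[X] ⧸ U) :=
    (U.mkQ.restrictScalars A) ∘ₗ
      ((Polynomial.CAlgHom (R := A) (A := MvPolynomial T A)).toLinearMap)
  have hlam : ∀ b, lam b = U.mkQ (C b) := fun b => rfl
  obtain ⟨m, hm⟩ : ∃ m, ∀ i, (h i).totalDegree ≤ m :=
    ⟨Finset.univ.sup fun i => (h i).totalDegree, fun i =>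
      Finset.le_sup (f := fun i => (h i).totalDegree) (Finset.mem_univ i)⟩
  let N := (MvPolynomial.restrictTotalDegree T A m).map lam
  have smulX : ∀ x : (MvPolynomial T A)[X], (X : A[X]) • x = X * x := by
    intro x
    rw [Algebra.smul_def]
    congr 1
    exact Polynomial.map_X _
  have hstab : ∀ n ∈ N, Algebra.lsmul A A ((MvPolynomial T A)[X] ⧸ U) (X : A[X]) n ∈ N := by
    rintro _ ⟨b, hb, rfl⟩
    have hb : b.totalDegree ≤ m := by
      simpa [MvPolynomial.mem_restrictTotalDegree] using hb
    rw [b.as_sum]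
    rw [map_sum, map_sum]
    refine Submodule.sum_mem _ fun a ha => ?_
    have hadeg : a.sum (fun _ e => e) ≤ m := (MvPolynomial.le_totalDegree ha).trans hb
    have : MvPolynomial.monomial a (b.coeff a) = (b.coeff a) • MvPolynomial.monomial a (1 : A) := by
      rw [MvPolynomial.smul_monomial, smul_eq_mul, mul_one]
    rw [this, map_smul, map_smul]
    refine Submodule.smul_mem _ _ ?_
    change (X : A[X]) • lam _ ∈ N
    by_cases hred : ∀ i, a i < d i
    · have : lam (MvPolynomial.monomial a 1) = 0 := by
        rw [hlam, Submodule.mkQ_apply, Submodule.Quotient.mk_eq_zero]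
        refine Submodule.mem_sup_right ⟨Pi.single (fun i => ⟨a i, hred i⟩) 1, ?_⟩
        simp only [ψ, Fintype.linearCombination_apply_single, one_smul, mon]
        rw [MvPolynomial.monomial_eq]
        simp [Finsupp.prod_fintype]
      rw [this, smul_zero]
      exact Submodule.zero_mem _
    · push Not at hred
      obtain ⟨i, hi⟩ := hred
      have e1 : MvPolynomial.monomial a (1 : A) =
          MvPolynomial.monomial (a - Finsupp.single i (d i)) 1 * MvPolynomial.X i ^ d i := by
        rw [MvPolynomial.X_pow_eq_monomial, MvPolynomial.monomial_mul, one_mul,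
          tsub_add_cancel_of_le]
        simpa using hi
      have e2 : (X : A[X]) • lam (MvPolynomial.monomial a 1) =
          lam (-(MvPolynomial.monomial (a - Finsupp.single i (d i)) 1 * f i)) := by
        rw [hlam, hlam, ← map_smul, ← sub_eq_zero, ← map_sub, Submodule.mkQ_apply,
          Submodule.Quotient.mk_eq_zero]
        refine Submodule.mem_sup_left ?_
        rw [Submodule.restrictScalars_mem]
        have : (X : A[X]) • C (MvPolynomial.monomial a (1 : A)) -
            C (-(MvPolynomial.monomial (a - Finsupp.single i (d i)) 1 * f i)) =
            C (MvPolynomial.monomial (a - Finsupp.single i (d i)) 1) * G i := by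
          rw [smulX, e1, hG]
          simp only [map_mul, map_neg]
          ring
        rw [this]
        exact Ideal.mul_mem_left _ _ (Ideal.subset_span ⟨i, rfl⟩)
      rw [e2]
      refine Submodule.mem_map_of_mem ?_
      rw [MvPolynomial.mem_restrictTotalDegree, MvPolynomial.totalDegree_neg]
      refine (MvPolynomial.totalDegree_mul _ _).trans ?_
      have h1 : (MvPolynomial.monomial (a - Finsupp.single i (d i)) (1 : A)).totalDegree ≤
          (a - Finsupp.single i (d i)).sum (fun _ e => e) :=
        MvPolynomial.totalDegree_monomial_le (a - Finsupp.single i (d i)) (1 : A)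
      have h2 : (a - Finsupp.single i (d i)).sum (fun _ e => e) + d i = a.sum fun _ e => e := by
        have : a = (a - Finsupp.single i (d i)) + Finsupp.single i (d i) := by
          rw [tsub_add_cancel_of_le]
          simpa using hi
        conv_rhs => rw [this]
        rw [Finsupp.sum_add_index' (by simp) (by simp)]
        simp
      have := hf i
      omega
  have : Module.Finite A N := Module.Finite.map _ _
  obtain ⟨p, hpm, hp⟩ := LinearMap.exists_monic_and_aeval_eq_zero A
    ((Algebra.lsmul A A ((MvPolynomial T A)[X] ⧸ U) (X : A[X])).restrict hstab)
  have hpN : ∀ n ∈ N, p • n = 0 := by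
    intro n hn
    have h1 := congrArg Subtype.val (LinearMap.congr_fun hp ⟨n, hn⟩)
    set τ := (Algebra.lsmul A A ((MvPolynomial T A)[X] ⧸ U) (X : A[X])).restrict hstab with hτ
    have hpow : ∀ (k : ℕ) (n : N), (((τ ^ k) n : N) : (MvPolynomial T A)[X] ⧸ U) =
        (X ^ k : A[X]) • (n : (MvPolynomial T A)[X] ⧸ U) := by
      intro k
      induction k with
      | zero => intro n; simp
      | succ k ih =>
        intro n
        rw [pow_succ', Module.End.mul_apply, pow_succ', mul_smul, ← ih]
        rfl
    have key : ∀ (q : A[X]) (n : N), ((aeval τ q n : N) : (MvPolynomial T A)[X] ⧸ U) =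
        q • (n : (MvPolynomial T A)[X] ⧸ U) := by
      intro q n
      induction q using Polynomial.induction_on' with
      | add q1 q2 h1 h2 =>
        rw [map_add, LinearMap.add_apply, Submodule.coe_add, h1, h2, add_smul]
      | monomial k a =>
        rw [aeval_monomial, Module.End.mul_apply, Module.algebraMap_end_apply, Submodule.coe_smul,
          hpow, ← smul_assoc, smul_eq_C_mul, C_mul_X_pow_eq_monomial]
    rw [key] at h1
    exact h1
  have hpU : ∀ i, ∃ g ∈ Ideal.span (Set.range G), ∃ w, g + ψ w = p • C (h i) := by
    intro i
    have : p • lam (h i) = 0 := hpN _ (Submodule.mem_map_of_mem (by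
      rw [MvPolynomial.mem_restrictTotalDegree]; exact hm i))
    rw [hlam, ← map_smul, Submodule.mkQ_apply, Submodule.Quotient.mk_eq_zero] at this
    obtain ⟨g, hg, _, ⟨w, rfl⟩, h⟩ := Submodule.mem_sup.1 this
    exact ⟨g, hg, w, h⟩
  choose g hg w hw using hpU
  have hnl : ¬ LinearIndependent A[X] w := by
    intro hli
    have := hli.fintype_card_le_finrank
    simp at this
    omega
  rw [Fintype.not_linearIndependent_iff] at hnl
  obtain ⟨r, hr, i, hri⟩ := hnl
  refine ⟨fun i => r i * p, ⟨i, mul_ne_zero hri hpm.ne_zero⟩, ?_⟩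
  have : ∑ i, (r i * p).map (MvPolynomial.C (σ := T)) * C (h i) = ∑ i, r i • g i := by
    have h3 : ∀ i, (r i * p).map (MvPolynomial.C (σ := T)) * C (h i) = r i • g i + ψ (r i • w i) := by
      intro i
      rw [map_smul, ← smul_add, hw, smul_smul, Algebra.smul_def]
      rfl
    simp_rw [h3]
    rw [Finset.sum_add_distrib, ← map_sum, hr, map_zero, add_zero]
  rw [this]
  refine Ideal.sum_mem _ fun i _ => ?_
  rw [Algebra.smul_def]
  exact Ideal.mul_mem_left _ _ (hg i)

open Polynomial in
lemma aux_count {A : Type*} [CommRing A] [IsDomain A] [IsNoetherianRing A] {T : Type*} [Fintype T]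
    (d : T → ℕ) (f : T → MvPolynomial T A) (hf : ∀ i, (f i).totalDegree ≤ d i)
    (Ps : Finset (Ideal (MvPolynomial T A)))
    (hPs : ∀ P ∈ Ps, P ∈ (Ideal.span (Set.range f)).minimalPrimes ∧
      (∀ a, MvPolynomial.C a ∈ P → a = 0) ∧ (Fintype.card T : ℕ∞) ≤ P.height) :
    Ps.card ≤ ∏ i, d i := by
  classical
  by_contra hcon
  push Not at hcon
  have hprime : ∀ P ∈ Ps, P.IsPrime := fun P hP => (hPs P hP).1.1.1
  have hex : ∀ P : Ps, ∃ h : MvPolynomial T A, (∀ Q : Ps, Q ≠ P → h ∈ Q.1) ∧ h ∉ P.1 := by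
    rintro ⟨P, hP⟩
    have := hprime P hP
    have hn : ¬ (Ps.erase P).inf id ≤ P := by
      rw [Ideal.IsPrime.inf_le' this]
      rintro ⟨Q, hQ, hle⟩
      obtain ⟨hne, hQ⟩ := Finset.mem_erase.1 hQ
      exact hne (le_antisymm hle ((hPs P hP).1.2 ⟨hprime Q hQ, (hPs Q hQ).1.1.2⟩ hle))
    obtain ⟨h, h1, h2⟩ := SetLike.not_le_iff_exists.1 hn
    refine ⟨h, fun Q hQ => ?_, h2⟩
    rw [Submodule.mem_finsetInf] at h1
    exact h1 Q.1 (Finset.mem_erase.2 ⟨fun h => hQ (Subtype.ext h), Q.2⟩)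
  choose h hh1 hh2 using hex
  obtain ⟨r, ⟨j, hj⟩, hr⟩ := aux_dep d f hf h (by simpa using hcon)
  obtain ⟨e, r', hr', i0, hi0⟩ : ∃ (e : ℕ) (r' : Ps → A[X]), (∀ i, r i = X ^ e * r' i) ∧
      ∃ i0, (r' i0).coeff 0 ≠ 0 := by
    obtain ⟨i0, hi0, hmin⟩ := Finset.exists_min_image (Finset.univ.filter fun i => r i ≠ 0)
      (fun i => (r i).natTrailingDegree) ⟨j, by simpa using hj⟩
    have hdvd : ∀ i, X ^ (r i0).natTrailingDegree ∣ r i := by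
      intro i
      by_cases hi : r i = 0
      · simp [hi]
      · rw [X_pow_dvd_iff]
        intro n hn
        apply coeff_eq_zero_of_lt_natTrailingDegree
        exact hn.trans_le (hmin i (by simpa using hi))
    choose r' hr' using hdvd
    refine ⟨_, r', hr', i0, ?_⟩
    have h0 : (r i0).coeff (r i0).natTrailingDegree ≠ 0 := by
      have : r i0 ≠ 0 := by simpa using hi0
      simpa [trailingCoeff] using this
    intro hc
    apply h0
    have : (r i0).coeff (r i0).natTrailingDegree = _ :=
      congrArg (fun p => p.coeff (r i0).natTrailingDegree) (hr' i0)
    rw [this]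
    have h2 := coeff_X_pow_mul (r' i0) (r i0).natTrailingDegree 0
    rw [zero_add] at h2
    rw [h2, hc]
  set u : (MvPolynomial T A)[X] := ∑ i, (r' i).map (MvPolynomial.C (σ := T)) * C (h i) with hu
  have hru : X ^ e * u ∈ 
      Ideal.span (Set.range fun i : T => C (f i) + X * C (MvPolynomial.X i ^ d i)) := by
    convert hr using 1
    rw [hu, Finset.mul_sum]
    refine Finset.sum_congr rfl fun i _ => ?_
    rw [hr' i, Polynomial.map_mul, Polynomial.map_pow, map_X, mul_assoc]
  obtain ⟨P, hP⟩ := i0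
  obtain ⟨hPmin, hP0, hPh⟩ := hPs P hP
  have hPp := hprime P hP
  let Ph : Ideal (MvPolynomial T A)[X] := P.comap (evalRingHom 0)
  have hPhp : Ph.IsPrime := hPp.comap _
  have hfP : ∀ i, f i ∈ P := fun i => hPmin.1.2 (Ideal.subset_span ⟨i, rfl⟩)
  have huP : u ∈ Ph := by
    by_contra huP
    have hle : Ideal.span (Set.range fun i : T => C (f i) + X * C (MvPolynomial.X i ^ d i)) ≤ Ph := by
      rw [Ideal.span_le]
      rintro _ ⟨i, rfl⟩
      change eval 0 _ ∈ P
      simpa using hfP i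
    obtain ⟨Q, hQ, hQP⟩ := Ideal.exists_minimalPrimes_le hle
    have hQp : Q.IsPrime := hQ.1.1
    have hX : X ∈ Q := by
      rcases hQp.mem_or_mem (hQ.1.2 hru) with h | h
      · exact hQp.mem_of_pow_mem _ h
      · exact absurd (hQP h) huP
    have hPq : P ≤ Q.comap C := by
      apply hPmin.2
      · refine ⟨hQp.comap _, ?_⟩
        rw [Ideal.span_le]
        rintro _ ⟨i, rfl⟩
        change C (f i) ∈ Q
        have := hQ.1.2 (Ideal.subset_span ⟨i, rfl⟩)
        exact (Ideal.add_mem_iff_left _ (Ideal.mul_mem_right _ _ hX)).1 this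
      · intro b hb
        have : eval 0 (C b) ∈ P := hQP hb
        simpa using this
    have hlt : P.map C < Q := by
      refine lt_of_le_of_ne (Ideal.map_le_iff_le_comap.2 hPq) ?_
      intro heq
      rw [← heq, Ideal.mem_map_C_iff] at hX
      have := hX 1
      rw [coeff_X_one] at this
      exact hPp.ne_top ((Ideal.eq_top_iff_one _).2 this)
    have h1 := aux_height_poly P Q hlt
    have h2 := Ideal.height_le_card_of_mem_minimalPrimes_span (Set.finite_range _) hQ
    have h3 : (Set.range fun i : T => C (f i) + X * C (MvPolynomial.X i ^ d i)).ncard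
        ≤ Fintype.card T := by
      rw [← Set.image_univ]
      refine (Set.ncard_image_le Set.finite_univ).trans ?_
      rw [Set.ncard_univ, Nat.card_eq_fintype_card]
    have h4 : (Fintype.card T : ℕ∞) + 1 ≤ Fintype.card T := by
      calc (Fintype.card T : ℕ∞) + 1 ≤ P.height + 1 := by gcongr
        _ ≤ _ := h1
        _ ≤ _ := h2
        _ ≤ _ := by exact_mod_cast h3
    have h5 : Fintype.card T + 1 ≤ Fintype.card T := by exact_mod_cast h4
    omega
  have hev : eval 0 u ∈ P := huP
  rw [hu, eval_finsetSum, Finset.sum_eq_add_sum_sdiff_singleton_of_mem (Finset.mem_univ (⟨P, hP⟩ : Ps))] at hev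
  rw [Ideal.add_mem_iff_left] at hev
  · rw [eval_mul, eval_C] at hev
    rcases hPp.mem_or_mem hev with h | h
    · rw [← coeff_zero_eq_eval_zero, coeff_map] at h
      exact hi0 (hP0 _ h)
    · exact hh2 ⟨P, hP⟩ h
  · refine Ideal.sum_mem _ fun i hi => ?_
    rw [eval_mul, eval_C]
    refine Ideal.mul_mem_left _ _ (hh1 i ⟨P, hP⟩ ?_)
    have : i ≠ ⟨P, hP⟩ := by simpa using hi
    exact this.symm

lemma aux_comap_min {R S : Type*} [CommRing R] [CommRing S] (E : R ≃+* S) {I P : Ideal S}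
    (h : P ∈ I.minimalPrimes) : P.comap E ∈ (I.comap E).minimalPrimes := by
  have h1 := Ideal.comap_minimalPrimes_eq_of_surjective (f := E.toRingHom) E.surjective I
  have h2 : P.comap E.toRingHom ∈ (I.comap E.toRingHom).minimalPrimes := by
    rw [h1]; exact ⟨P, h, rfl⟩
  exact h2

noncomputable def splitEquiv {σ : Type*} [DecidableEq σ] (F : Type*) [Field F] (S : Finset σ) :
    MvPolynomial σ F ≃ₐ[F] MvPolynomial {i // i ∉ S} (MvPolynomial {i // i ∈ S} F) :=
  (MvPolynomial.renameEquiv F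
    ((Equiv.sumComm _ _).trans (Equiv.sumCompl (fun i => i ∈ S))).symm).trans
    (MvPolynomial.sumAlgEquiv F _ _)

lemma splitEquiv_X_mem {σ : Type*} [DecidableEq σ] (F : Type*) [Field F] (S : Finset σ)
    (i : σ) (hi : i ∈ S) :
    splitEquiv F S (MvPolynomial.X i) = MvPolynomial.C (MvPolynomial.X ⟨i, hi⟩) := by
  simp [splitEquiv, hi]

lemma splitEquiv_X_not_mem {σ : Type*} [DecidableEq σ] (F : Type*) [Field F] (S : Finset σ)
    (i : σ) (hi : i ∉ S) :
    splitEquiv F S (MvPolynomial.X i) = MvPolynomial.X ⟨i, hi⟩ := by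
  simp [splitEquiv, hi]

lemma splitEquiv_rename {σ : Type*} [DecidableEq σ] (F : Type*) [Field F] (S : Finset σ)
    (a : MvPolynomial {i // i ∈ S} F) :
    splitEquiv F S (MvPolynomial.rename Subtype.val a) = MvPolynomial.C a := by
  have : ((splitEquiv F S).toAlgHom.comp (MvPolynomial.rename Subtype.val)) =
      (Algebra.ofId (MvPolynomial {i // i ∈ S} F)
        (MvPolynomial {i // i ∉ S} (MvPolynomial {i // i ∈ S} F))).restrictScalars F := by
    apply MvPolynomial.algHom_ext
    intro i
    simp [splitEquiv_X_mem F S i.1 i.2]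
  exact DFunLike.congr_fun this a

lemma splitEquiv_totalDegree {σ : Type*} [DecidableEq σ] (F : Type*) [Field F] (S : Finset σ)
    (g : MvPolynomial σ F) :
    (splitEquiv F S g).totalDegree ≤ g.totalDegree := by
  conv_lhs => rw [g.as_sum]
  rw [map_sum]
  refine MvPolynomial.totalDegree_finsetSum_le fun a ha => ?_
  refine le_trans ?_ (MvPolynomial.le_totalDegree ha)
  rw [MvPolynomial.monomial_eq, map_mul, Finsupp.prod, map_prod]
  refine (MvPolynomial.totalDegree_mul _ _).trans ?_
  have h1 : (splitEquiv F S (MvPolynomial.C (MvPolynomial.coeff a g))).totalDegree = 0 := by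
    have : splitEquiv F S (MvPolynomial.C (MvPolynomial.coeff a g)) =
        MvPolynomial.C (MvPolynomial.C (MvPolynomial.coeff a g)) := by
      rw [← splitEquiv_rename]; simp
    rw [this, MvPolynomial.totalDegree_C]
  rw [h1, zero_add]
  refine (MvPolynomial.totalDegree_finsetProd _ _).trans ?_
  refine Finset.sum_le_sum fun i _ => ?_
  rw [map_pow]
  refine (MvPolynomial.totalDegree_pow _ _).trans ?_
  have : (splitEquiv F S (MvPolynomial.X i)).totalDegree ≤ 1 := by
    by_cases hi : i ∈ S
    · rw [splitEquiv_X_mem F S i hi, MvPolynomial.totalDegree_C]; omega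
    · rw [splitEquiv_X_not_mem F S i hi, MvPolynomial.totalDegree_X]
  nlinarith

def FreeMod {σ : Type*} {F : Type*} [Field F] (S : Finset σ) (P : Ideal (MvPolynomial σ F)) : Prop :=
  ∀ a : MvPolynomial {i // i ∈ S} F, MvPolynomial.rename Subtype.val a ∈ P → a = 0

lemma FreeMod.mono {σ : Type*} {F : Type*} [Field F] {S S' : Finset σ}
    {P : Ideal (MvPolynomial σ F)} (h : FreeMod S P) (hS : S' ⊆ S) : FreeMod S' P := by
  intro a ha
  let ι : {i // i ∈ S'} → {i // i ∈ S} := fun i => ⟨i.1, hS i.2⟩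
  have hι : Function.Injective ι := fun x y hxy => by
    apply Subtype.ext
    exact congrArg (fun z : {i // i ∈ S} => z.1) hxy
  have := h (MvPolynomial.rename ι a) (by rw [MvPolynomial.rename_rename]; exact ha)
  exact MvPolynomial.rename_injective _ hι (by simpa using this)

lemma exists_freeMod {σ : Type*} [Fintype σ] [DecidableEq σ] {F : Type*} [Field F]
    (P : Ideal (MvPolynomial σ F)) [hP : P.IsPrime] (j : ℕ) (hj : P.height ≤ j) :
    ∃ S : Finset σ, S.card = Fintype.card σ - j ∧ FreeMod S P := by
  classical
  obtain ⟨S, hS, hmax⟩ := Finset.exists_max_image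
    (Finset.univ.filter fun S : Finset σ => FreeMod S P) Finset.card ⟨∅, by
      simp only [Finset.mem_filter, Finset.mem_univ, true_and]
      intro a ha
      have : IsEmpty {i : σ // i ∈ (∅ : Finset σ)} := ⟨fun x => absurd x.2 (Finset.notMem_empty _)⟩
      obtain ⟨c, rfl⟩ := MvPolynomial.C_surjective _ a
      rw [MvPolynomial.rename_C] at ha
      by_contra hc
      have hc : c ≠ 0 := fun h => hc (by rw [h, map_zero])
      exact hP.ne_top (Ideal.eq_top_of_isUnit_mem _ ha ((IsUnit.mk0 c hc).map MvPolynomial.C))⟩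
  simp only [Finset.mem_filter, Finset.mem_univ, true_and] at hS hmax
  let E := (splitEquiv F S).symm.toRingEquiv
  have hE : ∀ x, E x = (splitEquiv F S).symm x := fun _ => rfl
  have hh := aux_height_alg {i // i ∉ S} (P.comap E) (hP.comap _) (by
      intro a ha
      apply hS
      rw [Ideal.mem_comap, hE, ← splitEquiv_rename, AlgEquiv.symm_apply_apply] at ha
      exact ha) (by
      rintro ⟨i, hi⟩
      have hnot : ¬ FreeMod (insert i S) P := by
        intro hf
        have := hmax _ hf
        rw [Finset.card_insert_of_notMem hi] at this
        omega
      simp only [FreeMod] at hnot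
      push Not at hnot
      obtain ⟨a, ha, ha0⟩ := hnot
      have hr : ∀ a : MvPolynomial {x // x ∈ insert i S} F,
          ∃ g : Polynomial (MvPolynomial {i // i ∈ S} F),
          Polynomial.aeval (MvPolynomial.X (⟨i, hi⟩ : {i // i ∉ S})) g =
            splitEquiv F S (MvPolynomial.rename Subtype.val a) := by
        intro a
        induction a using MvPolynomial.induction_on with
        | C c => 
          refine ⟨Polynomial.C (MvPolynomial.C c), ?_⟩
          rw [Polynomial.aeval_C, MvPolynomial.rename_C]
          have := splitEquiv_rename F S (MvPolynomial.C c)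
          rw [MvPolynomial.rename_C] at this
          rw [this]; rfl
        | add p q hp hq =>
          obtain ⟨g, hg⟩ := hp
          obtain ⟨g', hg'⟩ := hq
          exact ⟨g + g', by simp [hg, hg']⟩
        | mul_X p n hp =>
          obtain ⟨g, hg⟩ := hp
          have : ∃ g' : Polynomial (MvPolynomial {i // i ∈ S} F),
              Polynomial.aeval (MvPolynomial.X (⟨i, hi⟩ : {i // i ∉ S})) g' =
                splitEquiv F S (MvPolynomial.X n.1) := by
            rcases Finset.mem_insert.1 n.2 with h | h
            · refine ⟨Polynomial.X, ?_⟩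
              rw [splitEquiv_X_not_mem F S n.1 (by rw [h]; exact hi), Polynomial.aeval_X]
              congr 1
              exact Subtype.ext h.symm
            · refine ⟨Polynomial.C (MvPolynomial.X ⟨n.1, h⟩), ?_⟩
              rw [splitEquiv_X_mem F S n.1 h, Polynomial.aeval_C]
              rfl
          obtain ⟨g', hg'⟩ := this
          exact ⟨g * g', by simp [hg, hg']⟩
      obtain ⟨g, hg⟩ := hr a
      refine ⟨g, ?_, ?_⟩
      · rintro rfl
        rw [map_zero] at hg
        have h1 := (map_eq_zero_iff _ (splitEquiv F S).injective).1 hg.symm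
        exact ha0 ((map_eq_zero_iff _ (MvPolynomial.rename_injective _ Subtype.val_injective)).1 h1)
      · rw [Ideal.mem_comap, hE, hg, AlgEquiv.symm_apply_apply]
        exact ha)
  rw [RingEquiv.height_comap E P] at hh
  have h2 : Nat.card {i // i ∉ S} ≤ j := by exact_mod_cast hh.trans hj
  have h3 : Nat.card {i // i ∉ S} = Fintype.card σ - S.card := by
    rw [Nat.card_eq_fintype_card]; simp [Fintype.card_subtype_compl]
  obtain ⟨S', hS', hc⟩ := Finset.exists_subset_card_eq (s := S) (n := Fintype.card σ - j) (by omega)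
  exact ⟨S', hc, hS.mono hS'⟩

def TypeSet {k : ℕ} {F : Type*} [Field F] (j : ℕ) (S : Finset (Fin k))
    (f : Fin k → MvPolynomial (Fin k) F) : Set (Ideal (MvPolynomial (Fin k) F)) :=
  {P | P ∈ (Ideal.span (f '' {i | i.1 < j})).minimalPrimes ∧ FreeMod S P ∧ (j : ℕ∞) ≤ P.height}

lemma typeSet_card {k : ℕ} {F : Type*} [Field F] (j : ℕ) (hj : j ≤ k) (S : Finset (Fin k))
    (hS : S.card = k - j) (d : Fin k → ℕ) (hd : ∀ i, 0 < d i)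
    (f : Fin k → MvPolynomial (Fin k) F) (hf : ∀ i, (f i).totalDegree ≤ d i)
    (Ps : Finset (Ideal (MvPolynomial (Fin k) F))) (hPs : ∀ P ∈ Ps, P ∈ TypeSet j S f) :
    Ps.card ≤ ∏ i, d i := by
  classical
  have hcard1 : Fintype.card {i // i ∉ S} = j := by
    simp [Fintype.card_subtype_compl]; omega
  have hcard2 : Fintype.card {i : Fin k // i.1 < j} = j := by
    rw [Fintype.card_subtype]
    have : (Finset.univ.filter fun i : Fin k => i.1 < j).card = j := by
      have := Fin.card_filter_val_lt (n := k) (m := j)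
      simpa [hj] using this
    exact this
  let φ : {i // i ∉ S} ≃ {i : Fin k // i.1 < j} := Fintype.equivOfCardEq (hcard1.trans hcard2.symm)
  let E := (splitEquiv F S).symm.toRingEquiv
  have hE : ∀ x, E x = (splitEquiv F S).symm x := fun _ => rfl
  have hinj : Function.Injective (fun P : Ideal (MvPolynomial (Fin k) F) => P.comap E) :=
    Ideal.comap_injective_of_surjective _ E.surjective
  have h1 := aux_count (fun i => d (φ i).1) (fun i => splitEquiv F S (f (φ i).1))
    (fun i => (splitEquiv_totalDegree F S _).trans (hf _))
    (Ps.map ⟨_, hinj⟩) (by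
      intro P hP
      obtain ⟨P, hP', rfl⟩ := Finset.mem_map.1 hP
      obtain ⟨hmin, hfree, hht⟩ := hPs P hP'
      refine ⟨?_, ?_, ?_⟩
      · have : Ideal.span (Set.range fun i => splitEquiv F S (f (φ i).1)) =
            (Ideal.span (f '' {i | i.1 < j})).comap E := by
          change _ = Ideal.comap (splitEquiv F S).toRingEquiv.symm _
          rw [Ideal.comap_symm, Ideal.map_span]
          congr 1
          ext x
          simp only [Set.mem_range, Set.mem_image, Set.mem_ofPred_eq]
          constructor
          · rintro ⟨i, rfl⟩
            exact ⟨_, ⟨_, (φ i).2, rfl⟩, rfl⟩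
          · rintro ⟨_, ⟨i, hi, rfl⟩, rfl⟩
            exact ⟨φ.symm ⟨i, hi⟩, by simp⟩
        rw [this]
        exact aux_comap_min E hmin
      · intro a ha
        apply hfree
        change MvPolynomial.C a ∈ P.comap E at ha
        rw [Ideal.mem_comap, hE, ← splitEquiv_rename, AlgEquiv.symm_apply_apply] at ha
        exact ha
      · rw [hcard1]
        change _ ≤ (P.comap E).height
        rw [RingEquiv.height_comap E P]
        exact hht)
  rw [Finset.card_map] at h1
  refine h1.trans ?_
  rw [Equiv.prod_comp φ (fun i => d i.1),
    ← Finset.prod_subtype (Finset.univ.filter fun i : Fin k => i.1 < j) (by simp) d]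
  exact Finset.prod_le_prod_of_subset_of_one_le' (Finset.filter_subset _ _) fun i _ _ => hd i

lemma exists_bad {k : ℕ} {F : Type*} [Field F] [Fintype F] (d : Fin k → ℕ)
    (f : Fin k → MvPolynomial (Fin k) F) (hf : ∀ i, (f i).totalDegree ≤ d i)
    (hN : ∏ i, d i < Nat.card {x : Fin k → F // ∀ i, MvPolynomial.eval x (f i) = 0}) :
    ∃ (j : Fin k) (S : Finset (Fin k)), S.card = k - j ∧ ∃ P ∈ TypeSet j S f, f j ∈ P := by
  classical
  by_contra hbad
  have hht : ∀ j ≤ k, ∀ Q : Ideal (MvPolynomial (Fin k) F), Q.IsPrime →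
      f '' {i | i.1 < j} ⊆ Q → (j : ℕ∞) ≤ Q.height := by
    intro j
    induction j with
    | zero => intro _ Q _ _; simp
    | succ j ih =>
      intro hj Q hQ hfQ
      have hsub : f '' {i | i.1 < j} ⊆ Q := by
        refine subset_trans (Set.image_mono ?_) hfQ
        intro i (hi : i.1 < j)
        exact Nat.lt_succ_of_lt hi
      obtain ⟨Q', hQ', hle⟩ := Ideal.exists_minimalPrimes_le (Ideal.span_le.2 hsub)
      have hp := hQ'.1.1
      have h1 := ih (by omega) Q' hp (Ideal.span_le.1 hQ'.1.2)
      have h2 : Q'.height ≤ j := by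
        refine (Ideal.height_le_card_of_mem_minimalPrimes_span (Set.toFinite _) hQ').trans ?_
        have : (f '' {i | i.1 < j}).ncard ≤ j := by
          refine (Set.ncard_image_le (Set.toFinite _)).trans ?_
          rw [Set.ncard_eq_toFinset_card']
          have := Fin.card_filter_val_lt (n := k) (m := j)
          simp only [Set.toFinset_ofPred]
          omega
        exact_mod_cast this
      obtain ⟨S, hS, hfree⟩ := exists_freeMod Q' j h2
      have h3 : f ⟨j, by omega⟩ ∉ Q' := by
        intro hmem
        exact hbad ⟨⟨j, by omega⟩, S, by simpa using hS, Q', ⟨hQ', hfree, h1⟩, hmem⟩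
      have hlt : Q' < Q := by
        refine lt_of_le_of_ne hle ?_
        rintro rfl
        exact h3 (hfQ ⟨⟨j, by omega⟩, by simp, rfl⟩)
      have := Ideal.height_add_one_le_of_lt_of_isPrime hlt
      push_cast
      exact le_trans (by gcongr) this
  let m : (Fin k → F) → Ideal (MvPolynomial (Fin k) F) := fun x => RingHom.ker (MvPolynomial.eval x)
  have hm : ∀ x p, p ∈ m x ↔ MvPolynomial.eval x p = 0 := fun x p => RingHom.mem_ker
  have hmp : ∀ x, (m x).IsPrime := fun x => RingHom.ker_isPrime _
  have hminj : Function.Injective m := by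
    intro x y hxy
    funext i
    have : MvPolynomial.X i - MvPolynomial.C (x i) ∈ m y := by
      rw [← hxy, hm]; simp
    rw [hm] at this
    simp only [map_sub, MvPolynomial.eval_X, MvPolynomial.eval_C] at this
    exact (sub_eq_zero.1 this).symm
  have hfm : ∀ x, (∀ i, MvPolynomial.eval x (f i) = 0) → Ideal.span (Set.range f) ≤ m x := by
    intro x hx
    rw [Ideal.span_le]
    rintro _ ⟨i, rfl⟩
    exact (hm _ _).2 (hx i)
  have hmin : ∀ x, (∀ i, MvPolynomial.eval x (f i) = 0) →
      m x ∈ (Ideal.span (Set.range f)).minimalPrimes := by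
    intro x hx
    have := hmp x
    obtain ⟨P, hP, hle⟩ := Ideal.exists_minimalPrimes_le (hfm x hx)
    rcases eq_or_lt_of_le hle with h | h
    · rw [← h]; exact hP
    · exfalso
      have hPp := hP.1.1
      have h1 := hht k le_rfl P hPp (by
        rintro _ ⟨i, -, rfl⟩
        exact hP.1.2 (Ideal.subset_span ⟨i, rfl⟩))
      have h2 := Ideal.height_add_one_le_of_lt_of_isPrime h
      have h3 : ((m x).height : WithBot ℕ∞) ≤ _ := Ideal.height_le_ringKrullDim_of_isPrime
      rw [MvPolynomial.ringKrullDim_of_isNoetherianRing, ringKrullDim_eq_zero_of_field,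
        zero_add, Nat.card_fin] at h3
      have h4 : (m x).height ≤ (k : ℕ∞) := by exact_mod_cast h3
      have h5 : (k : ℕ∞) + 1 ≤ k := le_trans (by gcongr) (h2.trans h4)
      have h6 : k + 1 ≤ k := by exact_mod_cast h5
      omega
  let Z : Finset (Fin k → F) := Finset.univ.filter fun x => ∀ i, MvPolynomial.eval x (f i) = 0
  have hZ : Nat.card {x : Fin k → F // ∀ i, MvPolynomial.eval x (f i) = 0} = Z.card := by
    rw [Nat.card_eq_fintype_card, Fintype.card_subtype]
  have h1 := aux_count d f hf (Z.map ⟨m, hminj⟩) (by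
    intro P hP
    obtain ⟨x, hx, rfl⟩ := Finset.mem_map.1 hP
    have hx : ∀ i, MvPolynomial.eval x (f i) = 0 := by simpa [Z] using hx
    have h0 : ∀ a, MvPolynomial.C a ∈ m x → a = 0 := by
      intro a ha
      rw [hm] at ha
      simpa using ha
    refine ⟨hmin x hx, h0, ?_⟩
    have := aux_height_alg (Fin k) (m x) (hmp x) h0 (fun i => 
      ⟨Polynomial.X - Polynomial.C (x i), Polynomial.X_sub_C_ne_zero _, by
        rw [hm]; simp⟩)
    rw [Nat.card_eq_fintype_card] at this
    exact this)
  rw [Finset.card_map] at h1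
  omega

def BadSet {k : ℕ} (F : Type*) [Field F] (d : Fin k → ℕ) (j : Fin k) (S : Finset (Fin k)) :
    Set (Fin k → MvPolynomial (Fin k) F) :=
  {f | (∀ i, (f i).totalDegree ≤ d i) ∧ S.card = k - j ∧ ∃ P ∈ TypeSet j S f, f j ∈ P}

lemma finite_deg {k : ℕ} (F : Type*) [Field F] [Fintype F] (d : Fin k → ℕ) :
    Finite {f : Fin k → MvPolynomial (Fin k) F // ∀ i, (f i).totalDegree ≤ d i} := by
  have : ∀ i, Finite (MvPolynomial.restrictTotalDegree (Fin k) F (d i)) := fun i =>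
    Module.finite_of_finite F
  let φ : {f : Fin k → MvPolynomial (Fin k) F // ∀ i, (f i).totalDegree ≤ d i} →
      (i : Fin k) → MvPolynomial.restrictTotalDegree (Fin k) F (d i) :=
    fun f i => ⟨f.1 i, (MvPolynomial.mem_restrictTotalDegree _ _ _).2 (f.2 i)⟩
  refine Finite.of_injective φ ?_
  intro f g h
  apply Subtype.ext
  funext i
  exact congrArg Subtype.val (congrFun h i)

lemma typeSet_congr {k : ℕ} {F : Type*} [Field F] (j : Fin k) (S : Finset (Fin k))
    (f g : Fin k → MvPolynomial (Fin k) F) (h : ∀ i ≠ j, f i = g i) :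
    TypeSet j S f = TypeSet j S g := by
  have : f '' {i | i.1 < j.1} = g '' {i | i.1 < j.1} := by
    apply Set.image_congr
    intro i (hi : i.1 < j.1)
    apply h
    rintro rfl
    omega
  simp only [TypeSet, this]

lemma badSet_card {k : ℕ} (F : Type*) [Field F] [Fintype F] (d : Fin k → ℕ) (hd : ∀ i, 0 < d i)
    (j : Fin k) (S : Finset (Fin k)) :
    (BadSet F d j S).ncard * Fintype.card F ^ d j ≤ (∏ i, d i) *
      Nat.card {f : Fin k → MvPolynomial (Fin k) F // ∀ i, (f i).totalDegree ≤ d i} := by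
  classical
  by_cases hS : S.card = k - j
  swap
  · have : BadSet F d j S = ∅ := by
      ext f
      simp [BadSet, hS]
    simp [this]
  obtain ⟨s, hs⟩ : S.Nonempty := by
    rw [← Finset.card_pos]; have := j.2; omega
  have hD : 0 < ∏ i, d i := Finset.prod_pos fun i _ => hd i
  have hfin := finite_deg F d
  have hidx : ∀ PP : Set (Ideal (MvPolynomial (Fin k) F)), ∃ idx : Ideal (MvPolynomial (Fin k) F) →
      Fin (∏ i, d i), (∀ Ps : Finset (Ideal (MvPolynomial (Fin k) F)), (∀ P ∈ Ps, P ∈ PP) →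
        Ps.card ≤ ∏ i, d i) → Set.InjOn idx PP := by
    intro PP
    have : Nonempty (Fin (∏ i, d i)) := ⟨⟨0, hD⟩⟩
    by_cases h : ∀ Ps : Finset (Ideal (MvPolynomial (Fin k) F)), (∀ P ∈ Ps, P ∈ PP) →
        Ps.card ≤ ∏ i, d i
    · have hf : PP.Finite := by
        by_contra hinf
        obtain ⟨t, ht, hc⟩ := Set.Infinite.exists_subset_card_eq hinf (∏ i, d i + 1)
        have := h t ht
        omega
      have hc := h hf.toFinset (by simp)
      have : Fintype PP := hf.fintype
      have h1 : Fintype.card PP ≤ Fintype.card (Fin (∏ i, d i)) := by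
        rw [Fintype.card_fin]
        convert hc
        rw [← Set.toFinset_card]
        congr 1
        ext; simp
      obtain ⟨e⟩ := Function.Embedding.nonempty_of_card_le h1
      refine ⟨fun P => if hP : P ∈ PP then e ⟨P, hP⟩ else Classical.arbitrary _, fun _ => ?_⟩
      intro P hP Q hQ hPQ
      simp only [hP, hQ, dif_pos] at hPQ
      exact congrArg Subtype.val (e.injective hPQ)
    · exact ⟨fun _ => Classical.arbitrary _, fun h' => absurd h' h⟩
  choose idx hidx using hidx
  let w0 : (Fin (d j) → F) → MvPolynomial {i // i ∈ S} F := fun c =>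
    ∑ n : Fin (d j), MvPolynomial.monomial (Finsupp.single ⟨s, hs⟩ (n : ℕ)) (c n)
  have hw0 : ∀ c c', w0 c = w0 c' → c = c' := by
    intro c c' h
    funext n
    have := congrArg (MvPolynomial.coeff (Finsupp.single ⟨s, hs⟩ (n : ℕ))) h
    simpa [w0, MvPolynomial.coeff_sum, MvPolynomial.coeff_monomial,
      (Finsupp.single_injective _).eq_iff, Fin.val_inj] using this
  let w : (Fin (d j) → F) → MvPolynomial (Fin k) F := fun c => MvPolynomial.rename Subtype.val (w0 c)
  have hwdeg : ∀ c, (w c).totalDegree ≤ d j := by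
    intro c
    refine (MvPolynomial.totalDegree_rename_le _ _).trans ?_
    refine MvPolynomial.totalDegree_finsetSum_le fun n _ => ?_
    refine (MvPolynomial.totalDegree_monomial_le _ _).trans ?_
    rw [Finsupp.sum_single_index]
    · exact n.2.le
    · rfl
  have hP : ∀ f : BadSet F d j S, ∃ P, P ∈ TypeSet j S f.1 ∧ f.1 j ∈ P := by
    rintro ⟨f, hf⟩
    obtain ⟨P, h1, h2⟩ := hf.2.2
    exact ⟨P, h1, h2⟩
  choose P hPt hPm using hP
  let Φ : BadSet F d j S × (Fin (d j) → F) → Fin (∏ i, d i) ×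
      {f : Fin k → MvPolynomial (Fin k) F // ∀ i, (f i).totalDegree ≤ d i} := fun x =>
    (idx (TypeSet j S x.1.1) (P x.1), ⟨Function.update x.1.1 j (x.1.1 j + w x.2), by
      intro i
      by_cases hi : i = j
      · subst hi
        rw [Function.update_self]
        exact (MvPolynomial.totalDegree_add _ _).trans (max_le (x.1.2.1 _) (hwdeg _))
      · rw [Function.update_of_ne hi]
        exact x.1.2.1 i⟩)
  have hΦ : Function.Injective Φ := by
    rintro ⟨f, c⟩ ⟨g, c'⟩ h
    have h1 : idx (TypeSet j S f.1) (P f) = idx (TypeSet j S g.1) (P g) := congrArg Prod.fst h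
    have h2 : Function.update f.1 j (f.1 j + w c) = Function.update g.1 j (g.1 j + w c') :=
      congrArg (fun z => z.2.1) h
    have h3 : ∀ i ≠ j, f.1 i = g.1 i := by
      intro i hi
      have := congrFun h2 i
      rwa [Function.update_of_ne hi, Function.update_of_ne hi] at this
    have h4 : f.1 j + w c = g.1 j + w c' := by
      have := congrFun h2 j
      rwa [Function.update_self, Function.update_self] at this
    have h5 := typeSet_congr j S f.1 g.1 h3
    have hPP : P f = P g := by
      rw [← h5] at h1
      refine hidx (TypeSet j S f.1) ?_ (hPt f) (by rw [h5]; exact hPt g) h1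
      intro Ps hPs
      exact typeSet_card j j.2.le S hS d hd f.1 f.2.1 Ps hPs
    have h6 : w c - w c' ∈ P f := by
      have : w c - w c' = g.1 j - f.1 j := by linear_combination h4
      rw [this]
      exact Ideal.sub_mem _ (hPP ▸ hPm g) (hPm f)
    have h7 : w0 c - w0 c' = 0 := by
      apply (hPt f).2.1
      rw [map_sub]
      exact h6
    have hc : c = c' := hw0 _ _ (sub_eq_zero.1 h7)
    subst hc
    have h8 : f.1 = g.1 := by
      funext i
      by_cases hi : i = j
      · subst hi; exact add_right_cancel h4
      · exact h3 i hi
    rw [Subtype.ext h8]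
  have := Nat.card_le_card_of_injective Φ hΦ
  rw [Nat.card_prod, Nat.card_prod] at this
  simpa [Nat.card_coe_set_eq] using this

theorem statement_3 (k : ℕ) (hk : 0 < k) (d : Fin k → ℕ) (hd : ∀ i, 0 < d i) :
    ∃ C : ℝ, 0 < C ∧
      ∀ (F : Type) [Field F] [Fintype F],
        (Nat.card {f : (i : Fin k) → MvPolynomial (Fin k) F //
            (∀ i, (f i).totalDegree ≤ d i) ∧
            ∏ i, d i <
              Nat.card {x : Fin k → F // ∀ i, MvPolynomial.eval x (f i) = 0}} : ℝ) ≤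
          C * (Fintype.card F : ℝ) ^ (-((⨅ i, d i : ℕ) : ℤ)) *
            Nat.card {f : (i : Fin k) → MvPolynomial (Fin k) F //
              ∀ i, (f i).totalDegree ≤ d i} := by
  classical
  have hD : 0 < ∏ i, d i := Finset.prod_pos fun i _ => hd i
  have : Nonempty (Fin k × Finset (Fin k)) := ⟨⟨⟨0, hk⟩, ∅⟩⟩
  refine ⟨(Fintype.card (Fin k × Finset (Fin k)) * ∏ i, d i : ℕ), ?_, ?_⟩
  · exact_mod_cast Nat.mul_pos Fintype.card_pos hD
  intro F _ _
  have hfin := finite_deg F d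
  have hfin' : {f : Fin k → MvPolynomial (Fin k) F | ∀ i, (f i).totalDegree ≤ d i}.Finite := hfin
  set Ω := Nat.card {f : (i : Fin k) → MvPolynomial (Fin k) F // ∀ i, (f i).totalDegree ≤ d i}
    with hΩ
  have hq : (1 : ℝ) < Fintype.card F := by exact_mod_cast Fintype.one_lt_card
  have hsub : {f : (i : Fin k) → MvPolynomial (Fin k) F | (∀ i, (f i).totalDegree ≤ d i) ∧
            ∏ i, d i < Nat.card {x : Fin k → F // ∀ i, MvPolynomial.eval x (f i) = 0}} ⊆
      ⋃ t ∈ (Finset.univ : Finset (Fin k × Finset (Fin k))), BadSet F d t.1 t.2 := by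
    rintro f ⟨hf, hN⟩
    obtain ⟨j, S, hS, hb⟩ := exists_bad d f hf hN
    simp only [Set.mem_iUnion]
    exact ⟨(j, S), Finset.mem_univ _, hf, hS, hb⟩
  have hcard := (Set.ncard_le_ncard hsub (hfin'.subset (by
    intro f hf
    simp only [Set.mem_iUnion] at hf
    obtain ⟨t, -, ht⟩ := hf
    exact ht.1))).trans (Finset.set_ncard_biUnion_le _ _)
  have hbad : ∀ t : Fin k × Finset (Fin k), ((BadSet F d t.1 t.2).ncard : ℝ) ≤
      (∏ i, d i : ℕ) * ((Fintype.card F : ℝ) ^ (-((⨅ i, d i : ℕ) : ℤ)) * Ω) := by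
    intro t
    have h1 := badSet_card F d hd t.1 t.2
    have h2 : ((BadSet F d t.1 t.2).ncard : ℝ) * (Fintype.card F : ℝ) ^ d t.1 ≤
      (∏ i, d i : ℕ) * Ω := by exact_mod_cast h1
    have hinf : (⨅ i, d i) ≤ d t.1 := ciInf_le (OrderBot.bddBelow _) _
    have h3 : (Fintype.card F : ℝ) ^ (⨅ i, d i) ≤ (Fintype.card F : ℝ) ^ d t.1 :=
      pow_le_pow_right₀ hq.le hinf
    rw [zpow_neg, zpow_natCast, ← mul_assoc, mul_comm _ (_⁻¹), mul_assoc, inv_mul_eq_div,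
      le_div_iff₀ (by positivity)]
    refine le_trans ?_ h2
    gcongr
  have hev : (Nat.card {f : (i : Fin k) → MvPolynomial (Fin k) F //
            (∀ i, (f i).totalDegree ≤ d i) ∧
            ∏ i, d i <
              Nat.card {x : Fin k → F // ∀ i, MvPolynomial.eval x (f i) = 0}} : ℝ) ≤
      ∑ t : Fin k × Finset (Fin k), ((BadSet F d t.1 t.2).ncard : ℝ) := by
    exact_mod_cast hcard
  refine hev.trans ((Finset.sum_le_sum fun t _ => hbad t).trans (le_of_eq ?_))
  rw [Finset.sum_const, Finset.card_univ, nsmul_eq_mul]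
  push_cast
  ring
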